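/- For the second derivatives of a smooth symmetric curvature function F at a diagonal matrix with distinct eigenvalues κ₁ < ... < κ_n, and a symmetric matrix η, one has F^{ij,kl} η_{ij} η_{kl} = Σ_{k,l} (∂²f/∂κ_k∂κ_l) η_{kk} η_{ll} + 2 Σ_{k>l} ((f^k − f^l)/(κ_k − κ_l)) η_{kl}², where f is the associated symmetric function of the eigenvalues and f^k = ∂f/∂κ_k. -/

import Mathlib

attribute [local instance] Matrix.normedAddCommGroup Matrix.normedSpace

/-- Two families with the same multiset of values agree up to a permutation of the indices. -/
lemma exists_perm_comp_eq_of_map_univ_eq {ι α : Type*} [Fintype ι] {v w : ι → α}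
    (h : Finset.univ.val.map v = Finset.univ.val.map w) :
    ∃ σ : Equiv.Perm ι, v ∘ σ = w := by
  classical
  have hcard : ∀ c, Fintype.card {i // w i = c} = Fintype.card {i // v i = c} := fun c => by
    have h1 := congrArg (Multiset.count c) h
    rw [Multiset.count_map, Multiset.count_map] at h1
    rw [Fintype.card_subtype, Fintype.card_subtype]
    simpa [Finset.card_def, Finset.filter_val, eq_comm] using h1.symm
  exact ⟨Equiv.ofFiberEquiv fun c => Fintype.equivOfCardEq (hcard c),
    funext fun i => Equiv.ofFiberEquiv_map _ i⟩

open Matrix in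
/-- The eigenvalues of a real diagonal matrix are its diagonal entries, up to a permutation. -/
lemma exists_perm_eigenvalues_diagonal {ι : Type*} [Fintype ι] [DecidableEq ι] (v : ι → ℝ)
    (hv : (diagonal v).IsHermitian) :
    ∃ σ : Equiv.Perm ι, v ∘ σ = hv.eigenvalues := by
  have h1 := hv.roots_charpoly_eq_eigenvalues
  rw [charpoly_diagonal, Polynomial.roots_prod _ _
    (Finset.prod_ne_zero_iff.2 fun i _ => Polynomial.X_sub_C_ne_zero _)] at h1
  exact exists_perm_comp_eq_of_map_univ_eq (by simpa [Multiset.bind_singleton] using h1)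

open Matrix in
/-- A function of the eigenvalues is invariant under orthogonal conjugation. -/
lemma apply_orthogonal_conj_of_eq_eigenvalues {ι : Type*} [Fintype ι] [DecidableEq ι]
    {F : Matrix ι ι ℝ → ℝ} {f : (ι → ℝ) → ℝ}
    (heig : ∀ (A : Matrix ι ι ℝ) (hA : A.IsHermitian), F A = f hA.eigenvalues)
    {A Q : Matrix ι ι ℝ} (hA : A.IsSymm) (hQ : Q * Qᵀ = 1) :
    F (Q * A * Qᵀ) = F A := by
  have hA' : A.IsHermitian := by
    rw [IsHermitian, conjTranspose_eq_transpose_of_trivial, hA.eq]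
  have hB : (Q * A * Qᵀ).IsHermitian := by
    simpa [conjTranspose_eq_transpose_of_trivial] using isHermitian_mul_mul_conjTranspose Q hA'
  rw [heig _ hB, heig _ hA', (hB.eigenvalues_eq_eigenvalues_iff hA').2]
  rw [charpoly_mul_comm, ← Matrix.mul_assoc, mul_eq_one_comm.1 hQ, Matrix.one_mul]

lemma hasDerivAt_matrix {m n : Type*} [Fintype m] [Fintype n] {A : ℝ → Matrix m n ℝ}
    {A' : Matrix m n ℝ} {t : ℝ} :
    HasDerivAt A A' t ↔ ∀ i j, HasDerivAt (fun s => A s i j) (A' i j) t := by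
  have h1 : HasDerivAt A A' t ↔ ∀ i, HasDerivAt (fun s => A s i) (A' i) t := hasDerivAt_pi
  rw [h1]
  exact forall_congr' fun i => hasDerivAt_pi

lemma hasDerivAt_clm_exp_smul_zero {𝔸 : Type*} [NormedRing 𝔸] [NormedAlgebra ℝ 𝔸]
    [FiniteDimensional ℝ 𝔸] (e : 𝔸 →L[ℝ] ℝ) (x : 𝔸) :
    HasDerivAt (fun t : ℝ => e (NormedSpace.exp (t • x))) (e x) 0 := by
  have : CompleteSpace 𝔸 := FiniteDimensional.complete ℝ 𝔸
  have h := e.hasFDerivAt.comp_hasDerivAt (0 : ℝ) (hasDerivAt_exp_smul_const (𝕂 := ℝ) x (0 : ℝ))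
  rw [zero_smul, NormedSpace.exp_zero, one_mul] at h
  exact h

open Matrix in
lemma hasDerivAt_exp_smul_apply_zero {ι : Type*} [Fintype ι] [DecidableEq ι]
    (S : Matrix ι ι ℝ) (i j : ι) :
    HasDerivAt (fun t : ℝ => NormedSpace.exp (t • S) i j) (S i j) 0 :=
  @hasDerivAt_clm_exp_smul_zero (Matrix ι ι ℝ) Matrix.linftyOpNormedRing
    Matrix.linftyOpNormedAlgebra inferInstance
    (LinearMap.toContinuousLinearMap (Matrix.entryLinearMap ℝ ℝ i j)) S

open Matrix in
/-- The differential of an orthogonally invariant function annihilates the tangent space of the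
orbit. -/
lemma fderiv_commutator_eq_zero {ι : Type*} [Fintype ι] [DecidableEq ι] {F : Matrix ι ι ℝ → ℝ}
    (hF : Differentiable ℝ F) {A S : Matrix ι ι ℝ}
    (hinv : ∀ Q : Matrix ι ι ℝ, Q * Qᵀ = 1 → F (Q * A * Qᵀ) = F A) (hS : Sᵀ = -S) :
    fderiv ℝ F A (S * A - A * S) = 0 := by
  set Q : ℝ → Matrix ι ι ℝ := fun t => NormedSpace.exp (t • S) with hQ
  have hQ0 : Q 0 = 1 := by simp [Q]
  have hQQ : ∀ t, Q t * (Q t)ᵀ = 1 := fun t => by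
    have h1 : (Q t)ᵀ = (Q t)⁻¹ := by
      simp only [Q]
      rw [← Matrix.exp_transpose, ← Matrix.exp_neg, transpose_smul, hS, smul_neg]
    rw [h1, Matrix.mul_nonsing_inv]
    exact (Matrix.isUnit_iff_isUnit_det _).1 (Matrix.isUnit_exp _)
  have hd : HasDerivAt (fun t => Q t * A * (Q t)ᵀ) (S * A - A * S) 0 := by
    rw [hasDerivAt_matrix]
    intro i j
    have key : HasDerivAt (fun t => ∑ k, (∑ l, Q t i l * A l k) * Q t j k)
        (∑ k, ((∑ l, S i l * A l k) * Q 0 j k + (∑ l, Q 0 i l * A l k) * S j k)) 0 :=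
      HasDerivAt.fun_sum fun k _ => (HasDerivAt.fun_sum fun l _ =>
        (hasDerivAt_exp_smul_apply_zero S i l).mul_const _).mul
          (hasDerivAt_exp_smul_apply_zero S j k)
    have hval : (S * A - A * S) i j =
        ∑ k, ((∑ l, S i l * A l k) * Q 0 j k + (∑ l, Q 0 i l * A l k) * S j k) := by
      have h2 : S * A - A * S = S * A * (Q 0)ᵀ + Q 0 * A * Sᵀ := by
        rw [hQ0, hS]; simp [sub_eq_add_neg]
      rw [h2, Matrix.add_apply, Finset.sum_add_distrib]
      rfl
    rw [hval]
    exact key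
  have h0 : Q 0 * A * (Q 0)ᵀ = A := by simp [hQ0]
  have h1 : HasDerivAt (fun t => F (Q t * A * (Q t)ᵀ)) (fderiv ℝ F A (S * A - A * S)) 0 := by
    have h3 : HasFDerivAt F (fderiv ℝ F A) (Q 0 * A * (Q 0)ᵀ) := by
      rw [h0]; exact (hF A).hasFDerivAt
    exact h3.comp_hasDerivAt 0 hd
  have h2 : (fun t => F (Q t * A * (Q t)ᵀ)) = fun _ => F A := funext fun t => hinv _ (hQQ t)
  rw [h2] at h1
  exact h1.unique (hasDerivAt_const _ _)

/-- Differentiating the identity `fderiv ℝ F x (T x) = 0` along a line. -/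
lemma fderiv_fderiv_apply_eq_neg {E : Type*} [NormedAddCommGroup E] [NormedSpace ℝ E] {F : E → ℝ}
    (T : E →L[ℝ] E) {x h : E} (hF : DifferentiableAt ℝ (fderiv ℝ F) x)
    (hinv : ∀ t : ℝ, fderiv ℝ F (x + t • h) (T (x + t • h)) = 0) :
    fderiv ℝ (fderiv ℝ F) x h (T x) = -fderiv ℝ F x (T h) := by
  have hl : HasDerivAt (fun t : ℝ => x + t • h) h 0 := by
    have h1 : HasDerivAt (fun t : ℝ => t • h) h 0 := by
      simpa using (hasDerivAt_id (0 : ℝ)).smul_const h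
    exact h1.const_add x
  have h0 : HasFDerivAt (fderiv ℝ F) (fderiv ℝ (fderiv ℝ F) x) (x + (0 : ℝ) • h) := by
    simpa using hF.hasFDerivAt
  have h1 : HasDerivAt (fun t : ℝ => fderiv ℝ F (x + t • h)) (fderiv ℝ (fderiv ℝ F) x h) 0 :=
    h0.comp_hasDerivAt (0 : ℝ) hl
  have h2 : HasDerivAt (fun t : ℝ => T (x + t • h)) (T h) 0 :=
    T.hasFDerivAt.comp_hasDerivAt (0 : ℝ) hl
  have h3 := h1.clm_apply h2
  simp only [hinv, zero_smul, add_zero] at h3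
  exact eq_neg_of_add_eq_zero_left (h3.unique (hasDerivAt_const _ _))

lemma fderiv_fderiv_comp_clm_apply {E G : Type*} [NormedAddCommGroup E] [NormedSpace ℝ E]
    [NormedAddCommGroup G] [NormedSpace ℝ G] {F : E → ℝ} (d : G →L[ℝ] E) {x : G}
    (hF : DifferentiableAt ℝ (fderiv ℝ F) (d x)) (u w : G) :
    fderiv ℝ (fun v => fderiv ℝ F (d v) (d w)) x u =
      fderiv ℝ (fderiv ℝ F) (d x) (d u) (d w) := by
  have h : HasFDerivAt (fun v => fderiv ℝ F (d v) (d w)) _ x :=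
    (hF.hasFDerivAt.comp x d.hasFDerivAt).clm_apply (hasFDerivAt_const (d w) x)
  rw [h.fderiv]
  simp

lemma sum_sum_eq_sum_sum_lt {ι : Type*} [Fintype ι] [LinearOrder ι] (g : ι → ι → ℝ)
    (hg : ∀ k, g k k = 0) :
    ∑ k, ∑ l, g k l = ∑ k, ∑ l ∈ Finset.univ.filter (fun l => l < k), (g k l + g l k) := by
  have h1 : ∑ k, ∑ l, (if l < k then g l k else 0) = ∑ k, ∑ l, (if k < l then g k l else 0) :=
    Finset.sum_comm
  simp only [Finset.sum_filter, Finset.sum_add_distrib]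
  rw [h1, ← Finset.sum_add_distrib]
  refine Finset.sum_congr rfl fun k _ => ?_
  rw [← Finset.sum_add_distrib]
  refine Finset.sum_congr rfl fun l _ => ?_
  rcases lt_trichotomy k l with h | rfl | h
  · simp [h, h.not_gt]
  · simp [hg]
  · simp [h, h.not_gt]

open Finset in
/-- Second derivatives of a smooth symmetric curvature function F(A) = f(eig(A)) at a
diagonal matrix with pairwise distinct eigenvalues κ₁ < ... < κ_n, applied to a
symmetric matrix η:
F^{ij,kl} η_{ij} η_{kl} = Σ_{k,l} f^{kl} η_{kk} η_{ll}
  + 2 Σ_{k>l} ((f^k − f^l)/(κ_k − κ_l)) η_{kl}². -/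
theorem second_deriv_symmetric_function (n : ℕ)
    (F : Matrix (Fin n) (Fin n) ℝ → ℝ) (f : (Fin n → ℝ) → ℝ)
    (hFsmooth : ContDiff ℝ (⊤ : ℕ∞) F) (hfsmooth : ContDiff ℝ (⊤ : ℕ∞) f)
    (hsym : ∀ σ : Equiv.Perm (Fin n), ∀ κ : Fin n → ℝ, f (κ ∘ σ) = f κ)
    (heig : ∀ (A : Matrix (Fin n) (Fin n) ℝ) (hA : A.IsHermitian),
      F A = f hA.eigenvalues)
    (κ : Fin n → ℝ) (hdist : StrictMono κ)
    (η : Matrix (Fin n) (Fin n) ℝ) (hη : η.IsSymm) :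
    (fderiv ℝ (fun A => fderiv ℝ F A) (Matrix.diagonal κ)) η η =
      (∑ k : Fin n, ∑ l : Fin n,
        (fderiv ℝ (fun κ' => fderiv ℝ f κ' (Pi.single l 1)) κ (Pi.single k 1)) *
          η k k * η l l) +
      2 * ∑ k : Fin n, ∑ l ∈ Finset.univ.filter (fun l : Fin n => l < k),
        ((fderiv ℝ f κ (Pi.single k 1) - fderiv ℝ f κ (Pi.single l 1)) /
          (κ k - κ l)) * η k l ^ 2 := by
  have hF1 : Differentiable ℝ F := hFsmooth.differentiable (by simp)
  have hF2 : Differentiable ℝ (fderiv ℝ F) :=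
    (hFsmooth.fderiv_right (m := 1) (by norm_cast)).differentiable (by simp)
  let d : (Fin n → ℝ) →L[ℝ] Matrix (Fin n) (Fin n) ℝ :=
    LinearMap.toContinuousLinearMap (Matrix.diagonalLinearMap (Fin n) ℝ ℝ)
  have hd : ∀ v, d v = Matrix.diagonal v := fun v => rfl
  have hfF : f = fun v => F (d v) := funext fun v => by
    obtain ⟨σ, hσ⟩ := exists_perm_eigenvalues_diagonal v (Matrix.isHermitian_diagonal v)
    rw [hd, heig _ (Matrix.isHermitian_diagonal v), ← hσ, hsym]
  have hf1 : ∀ v w, fderiv ℝ f v w = fderiv ℝ F (d v) (d w) := fun v w => by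
    have h : HasFDerivAt f ((fderiv ℝ F (d v)).comp d) v := by
      rw [hfF]
      exact (hF1 (d v)).hasFDerivAt.comp v d.hasFDerivAt
    rw [h.fderiv]; rfl
  have hf2 : ∀ u w, fderiv ℝ (fun v => fderiv ℝ f v w) κ u =
      fderiv ℝ (fderiv ℝ F) (d κ) (d u) (d w) := fun u w => by
    simp only [hf1]
    exact fderiv_fderiv_comp_clm_apply d (hF2 _) u w
  have hsum : ∀ v : Fin n → ℝ, v = ∑ k, v k • Pi.single k (1 : ℝ) := fun v =>
    pi_eq_sum_univ' v
  have hcomm : ∀ A S : Matrix (Fin n) (Fin n) ℝ, A.IsSymm → S.transpose = -S →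
      fderiv ℝ F A (S * A - A * S) = 0 := fun A S hA hS =>
    fderiv_commutator_eq_zero hF1
      (fun Q hQ => apply_orthogonal_conj_of_eq_eigenvalues heig hA hQ) hS
  have hκ : ∀ k l, k ≠ l → κ l - κ k ≠ 0 := fun k l hkl =>
    sub_ne_zero.2 fun h => hkl (hdist.injective h).symm
  -- every symmetric matrix is its diagonal part plus a commutator with `diagonal κ`
  have hdec : ∀ M : Matrix (Fin n) (Fin n) ℝ, M.IsSymm → ∃ S : Matrix (Fin n) (Fin n) ℝ,
      S.transpose = -S ∧ (∀ k l, S k l = M k l / (κ l - κ k)) ∧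
      M = d M.diag + (S * d κ - d κ * S) := fun M hM => by
    refine ⟨Matrix.of fun k l => M k l / (κ l - κ k), ?_, fun _ _ => rfl, ?_⟩
    · ext k l
      simp only [Matrix.transpose_apply, Matrix.of_apply, Matrix.neg_apply]
      rw [hM.apply, ← neg_sub (κ l), div_neg]
    · ext k l
      simp only [hd, Matrix.add_apply, Matrix.sub_apply, Matrix.mul_diagonal,
        Matrix.diagonal_mul, Matrix.of_apply]
      rcases eq_or_ne k l with rfl | h
      · simp
      · have := hκ k l h
        rw [Matrix.diagonal_apply_ne _ h]
        field_simp
        ring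
  have hdκ : (d κ).IsSymm := Matrix.isSymm_diagonal κ
  have hL : ∀ M : Matrix (Fin n) (Fin n) ℝ, M.IsSymm →
      fderiv ℝ F (d κ) M = ∑ k, M k k * fderiv ℝ f κ (Pi.single k 1) := fun M hM => by
    obtain ⟨S, hS, -, hMS⟩ := hdec M hM
    rw [hMS, map_add, hcomm _ _ hdκ hS, add_zero, ← hMS, hsum M.diag]
    simp [hf1]
  have hB : ∀ H S : Matrix (Fin n) (Fin n) ℝ, H.IsSymm → S.transpose = -S →
      fderiv ℝ (fderiv ℝ F) (d κ) H (S * d κ - d κ * S) =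
        -∑ k, (S * H - H * S) k k * fderiv ℝ f κ (Pi.single k 1) := fun H S hH hS => by
    let T : Matrix (Fin n) (Fin n) ℝ →L[ℝ] Matrix (Fin n) (Fin n) ℝ :=
      LinearMap.toContinuousLinearMap (LinearMap.mulLeft ℝ S - LinearMap.mulRight ℝ S)
    have h := fderiv_fderiv_apply_eq_neg T (hF2 (d κ))
      fun t => hcomm _ _ (hdκ.add (hH.smul t)) hS
    refine h.trans (congrArg Neg.neg (hL (S * H - H * S) ?_))
    simp only [Matrix.IsSymm, Matrix.transpose_sub, Matrix.transpose_mul, hS, hH.eq,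
      Matrix.mul_neg, Matrix.neg_mul]
    abel
  have hsymm : IsSymmSndFDerivAt ℝ F (d κ) :=
    hFsmooth.contDiffAt.isSymmSndFDerivAt (by simp; norm_cast)
  obtain ⟨S, hS, hSη, hηS⟩ := hdec η hη
  have hSkk : ∀ k, S k k = 0 := fun k => by simp [hSη]
  change fderiv ℝ (fderiv ℝ F) (d κ) η η = _
  have hexp : fderiv ℝ (fderiv ℝ F) (d κ) η η =
      fderiv ℝ (fderiv ℝ F) (d κ) (d η.diag) (d η.diag) +
      fderiv ℝ (fderiv ℝ F) (d κ) (d η.diag) (S * d κ - d κ * S) +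
      fderiv ℝ (fderiv ℝ F) (d κ) η (S * d κ - d κ * S) := by
    have h1 : fderiv ℝ (fderiv ℝ F) (d κ) η η =
        fderiv ℝ (fderiv ℝ F) (d κ) η (d η.diag) +
        fderiv ℝ (fderiv ℝ F) (d κ) η (S * d κ - d κ * S) := by
      rw [← map_add, ← hηS]
    have h2 : fderiv ℝ (fderiv ℝ F) (d κ) (d η.diag) η =
        fderiv ℝ (fderiv ℝ F) (d κ) (d η.diag) (d η.diag) +
        fderiv ℝ (fderiv ℝ F) (d κ) (d η.diag) (S * d κ - d κ * S) := by
      rw [← map_add, ← hηS]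
    rw [h1, ← h2]
    exact congrArg (· + _) (hsymm _ _)
  have hdiag : fderiv ℝ (fderiv ℝ F) (d κ) (d η.diag) (d η.diag) =
      ∑ k : Fin n, ∑ l : Fin n,
        (fderiv ℝ (fun κ' => fderiv ℝ f κ' (Pi.single l 1)) κ (Pi.single k 1)) *
          η k k * η l l := by
    simp only [hf2]
    conv_lhs => rw [hsum η.diag]
    simp only [map_sum, map_smul, _root_.sum_apply, _root_.smul_apply,
      smul_eq_mul, Matrix.diag_apply, Finset.mul_sum]
    rw [Finset.sum_comm]
    refine Finset.sum_congr rfl fun k _ => Finset.sum_congr rfl fun l _ => ?_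
    ring
  rw [hexp, hdiag, hB (d η.diag) S (Matrix.isSymm_diagonal _) hS, hB η S hη hS]
  have hzero : ∑ k, (S * d η.diag - d η.diag * S) k k * fderiv ℝ f κ (Pi.single k 1) = 0 := by
    simp [hd, hSkk]
  rw [hzero, neg_zero, add_zero]
  congr 1
  have hg := sum_sum_eq_sum_sum_lt
    (fun k l => fderiv ℝ f κ (Pi.single k 1) / (κ k - κ l) * η k l ^ 2) (by simp)
  have hrhs : ∑ k : Fin n, ∑ l ∈ Finset.univ.filter (fun l : Fin n => l < k),
        ((fderiv ℝ f κ (Pi.single k 1) - fderiv ℝ f κ (Pi.single l 1)) /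
          (κ k - κ l)) * η k l ^ 2 =
      ∑ k, ∑ l, fderiv ℝ f κ (Pi.single k 1) / (κ k - κ l) * η k l ^ 2 := by
    rw [hg]
    refine Finset.sum_congr rfl fun k _ => Finset.sum_congr rfl fun l _ => ?_
    rw [hη.apply k l, ← neg_sub (κ k) (κ l), div_neg, sub_div]
    ring
  rw [hrhs, ← Finset.sum_neg_distrib, Finset.mul_sum]
  refine Finset.sum_congr rfl fun k _ => ?_
  rw [Matrix.sub_apply, Matrix.mul_apply, Matrix.mul_apply, ← Finset.sum_sub_distrib,
    Finset.sum_mul, ← Finset.sum_neg_distrib, Finset.mul_sum]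
  refine Finset.sum_congr rfl fun l _ => ?_
  rw [hSη, hSη, hη.apply k l, ← neg_sub (κ k) (κ l), div_neg]
  ring
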